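/- Proposition 2(i) (rank form): Let n, n', d be positive integers with min{n,n'} > d > 1, and let G be an n'×n matrix with 0/1 entries in which every row has exactly one entry equal to 1 (an ambiguous guessing game matrix with k = n' guessing rows). Then (G, d) is a tight Bell inequality (facet) of C_d^{n→n'} if and only if rank(G) > d. -/

import Mathlib

open Finset

/-- A classical channel: an `n' × n` column-stochastic real matrix. -/
def IsChannel {n n' : ℕ} (P : Matrix (Fin n') (Fin n) ℝ) : Prop :=
  (∀ y x, 0 ≤ P y x) ∧ ∀ x, ∑ y, P y x = 1

/-- A vertex of the signaling polytope: a column-stochastic 0/1 matrix with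
at most `d` nonzero rows. -/
def IsVertex {n n' : ℕ} (d : ℕ) (V : Matrix (Fin n') (Fin n) ℝ) : Prop :=
  IsChannel V ∧ (∀ y x, V y x = 0 ∨ V y x = 1) ∧
    ({y : Fin n' | ∃ x, V y x ≠ 0}).ncard ≤ d

/-- The signaling polytope `C_d^{n → n'}`. -/
def signalingPolytope (n n' d : ℕ) : Set (Matrix (Fin n') (Fin n) ℝ) :=
  convexHull ℝ {V | IsVertex d V}

/-- The Euclidean inner product `⟨G, P⟩ = ∑_{x,y} G_{y,x} P(y|x)`. -/
def bip {n n' : ℕ} (G P : Matrix (Fin n') (Fin n) ℝ) : ℝ :=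
  ∑ x, ∑ y, G y x * P y x

/-- `(G, γ)` is a tight Bell inequality (facet) of `C_d^{n → n'}`: it is valid on the
signaling polytope and is saturated by `n (n' - 1)` affinely independent vertices. -/
def IsTightBell (n n' d : ℕ) (G : Matrix (Fin n') (Fin n) ℝ) (γ : ℝ) : Prop :=
  (∀ P ∈ signalingPolytope n n' d, bip G P ≤ γ) ∧
  ∃ V : Fin (n * (n' - 1)) → Matrix (Fin n') (Fin n) ℝ,
    AffineIndependent ℝ V ∧ ∀ i, IsVertex d (V i) ∧ bip G (V i) = γ

/-- The input assignments `v` with `d` outputs whose deterministic channel saturates the guessing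
game of `f`: on a set `T` of `d` inputs `v` is a section of `f`, and it takes no other outputs. -/
def IsSaturating {X Y : Type*} [DecidableEq Y] (f : Y → X) (d : ℕ) (v : X → Y) : Prop :=
  ∃ T : Finset X, #T = d ∧ (∀ x ∈ T, f (v x) = x) ∧ ∀ x, v x ∈ T.image v

section Combinatorics

variable {X Y : Type*} [DecidableEq X] {f : Y → X} {d : ℕ}

lemma exists_section_through_pair (f : Y → X) {y y' : Y} (h : f y ≠ f y') :
    ∃ g : X → Y, (∀ x ∈ Set.range f, f (g x) = x) ∧ g (f y) = y ∧ g (f y') = y' := by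
  have : Nonempty Y := ⟨y⟩
  refine ⟨Function.update (Function.update (Function.invFun f) (f y) y) (f y') y', ?_, ?_, ?_⟩
  · intro x hx
    by_cases h1 : x = f y'
    · simp [h1]
    by_cases h2 : x = f y
    · simp [h2, h]
    simp only [Function.update_of_ne h1, Function.update_of_ne h2]
    exact Function.invFun_eq hx
  · simp [h]
  · simp

lemma exists_image_ne_ne [Fintype Y] (hr : 2 < #(univ.image f)) (x x' : X) :
    ∃ y, f y ≠ x ∧ f y ≠ x' := by
  obtain ⟨z, hz, hz'⟩ := exists_mem_notMem_of_card_lt_card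
    ((card_le_two (a := x) (b := x')).trans_lt hr)
  obtain ⟨y, -, rfl⟩ := mem_image.1 hz
  exact ⟨y, by simpa using hz'⟩

lemma sum_ite_eq_sum_of_eq_zero [Fintype X] {A : Y → X → ℝ}
    {T : Finset X} {g : X → Y} {y : Y}
    (hA : ∀ y x, f y ≠ x → A y x = 0) (hy : f y ∈ T) :
    ∑ x, A (if x ∈ T then g x else y) x = ∑ x ∈ T, A (g x) x := by
  rw [← sum_subset (subset_univ T)]
  · exact sum_congr rfl fun x hx => by simp [hx]
  · intro x _ hx
    simp only [hx, if_false]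
    exact hA _ _ fun h => hx (h ▸ hy)

variable [DecidableEq Y]

lemma isSaturating_ite {T : Finset X} {g w : X → Y} (hT : #T = d) (hg : ∀ x ∈ T, f (g x) = x)
    (hw : ∀ x ∉ T, w x ∈ T.image g) :
    IsSaturating f d (fun x => if x ∈ T then g x else w x) := by
  refine ⟨T, hT, fun x hx => by simp [hx, hg x hx], fun x => ?_⟩
  have himage : T.image (fun x => if x ∈ T then g x else w x) = T.image g :=
    image_congr fun x hx => if_pos hx
  rw [himage]
  by_cases hx : x ∈ T
  · simpa [hx] using ⟨x, hx, rfl⟩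
  · simpa [hx] using hw x hx

variable [Fintype X] [Fintype Y] {A : Y → X → ℝ}

lemma eq_of_sum_saturating_eq_zero_of_ne (hd : 1 < d) (hr : d < #(univ.image f))
    (hA : ∀ v, IsSaturating f d v → ∑ x, A (v x) x = 0) {x : X} {y y' : Y}
    (hy : f y ≠ x) (hy' : f y' ≠ x) (hyy : f y ≠ f y') : A y x = A y' x := by
  obtain ⟨g, hg, hgy, hgy'⟩ := exists_section_through_pair f hyy
  have hsub : {f y, f y'} ⊆ (univ.image f).erase x := by
    intro z hz
    simp only [mem_insert, mem_singleton] at hz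
    rcases hz with rfl | rfl <;> simp [hy, hy']
  have hle : d ≤ #((univ.image f).erase x) := by
    have := pred_card_le_card_erase (s := univ.image f) (a := x)
    omega
  obtain ⟨T, hT₁, hT₂, hT⟩ := exists_subsuperset_card_eq hsub (by rw [card_pair hyy]; omega) hle
  have hyT : f y ∈ T := hT₁ (by simp)
  have hy'T : f y' ∈ T := hT₁ (by simp)
  have hxT : x ∉ T := fun h => by simpa using hT₂ h
  have hgT : ∀ z ∈ T, f (g z) = z := fun z hz => hg z <| by
    simpa using (mem_erase.1 (hT₂ hz)).2
  have hyI : y ∈ T.image g := mem_image.2 ⟨_, hyT, hgy⟩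
  have hy'I : y' ∈ T.image g := mem_image.2 ⟨_, hy'T, hgy'⟩
  have h₁ := hA _ (isSaturating_ite (w := fun _ => y) hT hgT fun _ _ => hyI)
  have h₂ := hA _ (isSaturating_ite (w := fun z => if z = x then y' else y) hT hgT
    fun z _ => by by_cases h : z = x <;> simp only [h, if_true, if_false] <;> assumption)
  rw [← add_sum_erase _ _ (mem_univ x)] at h₁ h₂
  have hrest : ∑ z ∈ univ.erase x, A (if z ∈ T then g z else y) z =
      ∑ z ∈ univ.erase x, A (if z ∈ T then g z else if z = x then y' else y) z :=
    sum_congr rfl fun z hz => by simp [(mem_erase.1 hz).1]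
  simp only [hxT, if_true, if_false] at h₁ h₂
  linarith

lemma eq_of_sum_saturating_eq_zero (hd : 1 < d) (hr : d < #(univ.image f))
    (hA : ∀ v, IsSaturating f d v → ∑ x, A (v x) x = 0) {x : X} {y y' : Y}
    (hy : f y ≠ x) (hy' : f y' ≠ x) : A y x = A y' x := by
  by_cases hyy : f y = f y'
  · obtain ⟨z, hzy, hzx⟩ := exists_image_ne_ne (f := f) (by omega) (f y) x
    exact (eq_of_sum_saturating_eq_zero_of_ne hd hr hA hy hzx hzy.symm).trans
      (eq_of_sum_saturating_eq_zero_of_ne hd hr hA hzx hy' (hyy ▸ hzy))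
  · exact eq_of_sum_saturating_eq_zero_of_ne hd hr hA hy hy' hyy

lemma diag_eq_of_sum_saturating_eq_zero_of_ne (hd : 1 < d) (hr : d < #(univ.image f))
    (hA : ∀ v, IsSaturating f d v → ∑ x, A (v x) x = 0) (hA₀ : ∀ y x, f y ≠ x → A y x = 0)
    {y y' : Y} (hyy : f y ≠ f y') : A y (f y) = A y' (f y') := by
  obtain ⟨g, hg, hgy, hgy'⟩ := exists_section_through_pair f hyy
  have hle : d - 1 ≤ #(((univ.image f).erase (f y)).erase (f y')) := by
    rw [card_erase_of_mem (by simp [hyy.symm]), card_erase_of_mem (by simp)]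
    omega
  obtain ⟨T, hT, hTd⟩ := exists_subset_card_eq hle
  have hyT : f y ∉ T := fun h => by simpa using hT h
  have hy'T : f y' ∉ T := fun h => by simpa using hT h
  have hgT : ∀ z ∈ T, f (g z) = z := fun z hz => hg z <| by
    simpa using (mem_erase.1 (mem_erase.1 (hT hz)).2).2
  have key : ∀ s, f s ∉ T → g (f s) = s → A s (f s) + ∑ x ∈ T, A (g x) x = 0 := by
    intro s hs hgs
    have h := hA _ (isSaturating_ite (T := insert (f s) T) (g := g) (w := fun _ => s)
      (by rw [card_insert_of_notMem hs]; omega)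
      (fun z hz => by
        rcases mem_insert.1 hz with rfl | hz
        · rw [hgs]
        · exact hgT z hz)
      fun _ _ => mem_image.2 ⟨_, mem_insert_self _ _, hgs⟩)
    rwa [sum_ite_eq_sum_of_eq_zero hA₀ (mem_insert_self _ _), sum_insert hs, hgs] at h
  linarith [key y hyT hgy, key y' hy'T hgy']

/-- A functional which vanishes on all saturating assignments and on one off-game entry of each
column vanishes. -/
lemma eq_zero_of_sum_saturating_eq_zero (hd : 1 < d) (hr : d < #(univ.image f))
    (hA : ∀ v, IsSaturating f d v → ∑ x, A (v x) x = 0) (c : X → Y) (hc : ∀ x, f (c x) ≠ x)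
    (hAc : ∀ x, A (c x) x = 0) (y : Y) (x : X) : A y x = 0 := by
  have hA₀ : ∀ y x, f y ≠ x → A y x = 0 := fun y x h =>
    (eq_of_sum_saturating_eq_zero hd hr hA h (hc x)).trans (hAc x)
  by_cases hyx : f y = x
  swap
  · exact hA₀ y x hyx
  subst hyx
  have hconst : ∀ y', A y' (f y') = A y (f y) := by
    intro y'
    by_cases h : f y' = f y
    · obtain ⟨z, hz, -⟩ := exists_image_ne_ne (f := f) (by omega) (f y) (f y)
      exact (diag_eq_of_sum_saturating_eq_zero_of_ne hd hr hA hA₀ (h ▸ hz.symm)).trans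
        (diag_eq_of_sum_saturating_eq_zero_of_ne hd hr hA hA₀ hz)
    · exact diag_eq_of_sum_saturating_eq_zero_of_ne hd hr hA hA₀ h
  obtain ⟨g, hg, -, -⟩ := exists_section_through_pair f (hc (f y))
  obtain ⟨T, hT₁, hT₂, hT⟩ := exists_subsuperset_card_eq (s := {f y}) (t := univ.image f)
    (by simp) (by simpa using hd.le) hr.le
  have hyT : f y ∈ T := hT₁ (by simp)
  have hgT : ∀ z ∈ T, f (g z) = z := fun z hz => hg z <| by simpa using hT₂ hz
  have hfgy := hgT _ hyT
  have h := hA _ (isSaturating_ite (w := fun _ => g (f y)) hT hgT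
    fun _ _ => mem_image_of_mem g hyT)
  rw [sum_ite_eq_sum_of_eq_zero hA₀ (hfgy.symm ▸ hyT), sum_congr rfl
    fun x hx => (by rw [← hconst (g x), hgT x hx] : A (g x) x = A y (f y))] at h
  have hd₀ : (d : ℝ) ≠ 0 := by positivity
  simpa [hT, hd₀] using h

end Combinatorics

/-- The channel which deterministically outputs `v x` on the input `x`. -/
def detChannel {n n' : ℕ} (v : Fin n → Fin n') : Matrix (Fin n') (Fin n) ℝ :=
  Matrix.of fun y x => if v x = y then 1 else 0

section Channels

variable {n n' d : ℕ} {G V : Matrix (Fin n') (Fin n) ℝ} {f : Fin n' → Fin n} {v : Fin n → Fin n'}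

lemma detChannel_apply (v : Fin n → Fin n') (y : Fin n') (x : Fin n) :
    detChannel v y x = if v x = y then 1 else 0 := rfl

lemma ncard_nonzero_rows_detChannel (v : Fin n → Fin n') :
    ({y : Fin n' | ∃ x, detChannel v y x ≠ 0}).ncard = #(univ.image v) := by
  rw [← Set.ncard_coe_finset]
  congr 1
  ext y
  simp [detChannel_apply]

lemma isVertex_detChannel (hv : #(univ.image v) ≤ d) : IsVertex d (detChannel v) := by
  refine ⟨⟨fun y x => ?_, fun x => by simp [detChannel_apply]⟩, fun y x => ?_, ?_⟩
  · rw [detChannel_apply]; split_ifs <;> norm_num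
  · rw [detChannel_apply]; split_ifs <;> simp
  · rwa [ncard_nonzero_rows_detChannel]

lemma IsVertex.exists_eq_detChannel (hV : IsVertex d V) :
    ∃ v : Fin n → Fin n', V = detChannel v ∧ #(univ.image v) ≤ d := by
  obtain ⟨⟨-, hsum⟩, h01, hcard⟩ := hV
  have hex : ∀ x, ∃ y, V y x = 1 := by
    intro x
    by_contra! h
    have : ∑ y, V y x = 0 := sum_eq_zero fun y _ => (h01 y x).resolve_right (h y)
    linarith [hsum x]
  choose v hv using hex
  have hVv : V = detChannel v := by
    ext y x
    rw [detChannel_apply]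
    split_ifs with h
    · rw [← h, hv]
    · have hs := hsum x
      rw [← add_sum_erase _ _ (mem_univ (v x)), hv, add_eq_left,
        sum_eq_zero_iff_of_nonneg fun z _ => by rcases h01 z x with h | h <;> simp [h]] at hs
      exact hs y (by simp [Ne.symm h])
  refine ⟨v, hVv, ?_⟩
  rwa [← ncard_nonzero_rows_detChannel, ← hVv]

lemma bip_detChannel (hf : ∀ y x, G y x = if f y = x then 1 else 0) (v : Fin n → Fin n') :
    bip G (detChannel v) = #{y | v (f y) = y} := by
  unfold bip
  rw [sum_comm]
  simp only [hf, ite_mul, one_mul, zero_mul, sum_ite_eq, mem_univ, if_true]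
  simp [detChannel_apply]

lemma filter_fixed_subset_image (f : Fin n' → Fin n) (v : Fin n → Fin n') :
    ({y | v (f y) = y} : Finset (Fin n')) ⊆ univ.image v := fun y hy =>
  mem_image.2 ⟨f y, mem_univ _, (mem_filter.1 hy).2⟩

lemma IsSaturating.isVertex (hv : IsSaturating f d v) : IsVertex d (detChannel v) := by
  obtain ⟨T, hT, -, hv⟩ := hv
  refine isVertex_detChannel <| (card_le_card (t := T.image v) ?_).trans (hT ▸ card_image_le)
  intro y hy
  obtain ⟨x, -, rfl⟩ := mem_image.1 hy
  exact hv x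

lemma IsSaturating.bip_eq (hf : ∀ y x, G y x = if f y = x then 1 else 0)
    (hv : IsSaturating f d v) : bip G (detChannel v) = d := by
  obtain ⟨T, hT, hT₁, hT₂⟩ := hv
  have hfix : ({y | v (f y) = y} : Finset (Fin n')) = T.image v := by
    ext y
    constructor
    · intro hy
      rw [← (mem_filter.1 hy).2]
      exact hT₂ _
    · intro hy
      obtain ⟨x, hx, rfl⟩ := mem_image.1 hy
      simp [hT₁ x hx]
  rw [bip_detChannel hf, hfix, card_image_of_injOn, hT]
  intro x hx x' hx' h
  rw [← hT₁ x hx, ← hT₁ x' hx', h]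

lemma isLinearMap_bip (G : Matrix (Fin n') (Fin n) ℝ) : IsLinearMap ℝ (bip G) where
  map_add P Q := by simp [bip, mul_add, sum_add_distrib]
  map_smul c P := by simp [bip, mul_sum, mul_left_comm]

lemma bip_le_of_mem_signalingPolytope (hf : ∀ y x, G y x = if f y = x then 1 else 0)
    {P : Matrix (Fin n') (Fin n) ℝ} (hP : P ∈ signalingPolytope n n' d) : bip G P ≤ d := by
  refine convexHull_min ?_ (convex_halfSpace_le (isLinearMap_bip G) (d : ℝ)) hP
  intro V hV
  obtain ⟨v, rfl, hv⟩ := hV.exists_eq_detChannel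
  rw [Set.mem_ofPred_eq, bip_detChannel hf]
  exact_mod_cast (card_le_card (filter_fixed_subset_image f v)).trans hv

lemma rank_eq_card_image (hf : ∀ y x, G y x = if f y = x then 1 else 0) :
    G.rank = #(univ.image f) := by
  have hrow : Set.range G.row =
      Set.range fun x : univ.image f => (Pi.single x.1 1 : Fin n → ℝ) := by
    have hG : ∀ y, G.row y = Pi.single (f y) 1 := fun y => by
      ext x
      simp [Matrix.row, hf, Pi.single_apply, eq_comm]
    ext w
    simp [hG]
  rw [Matrix.rank_eq_finrank_span_row, hrow]
  exact (finrank_span_eq_card ((Pi.linearIndependent_single_one (Fin n) ℝ).comp _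
    Subtype.val_injective)).trans (Fintype.card_coe _)

lemma isTightBell_of_lt_card_image (hd : 1 < d) (hr : d < #(univ.image f))
    (hf : ∀ y x, G y x = if f y = x then 1 else 0) : IsTightBell n n' d G d := by
  refine ⟨fun P => bip_le_of_mem_signalingPolytope hf, ?_⟩
  have hc : ∀ x, ∃ y, f y ≠ x := fun x => by
    obtain ⟨y, hy, -⟩ := exists_image_ne_ne (f := f) (by omega) x x
    exact ⟨y, hy⟩
  choose c hc using hc
  let S : Set (Matrix (Fin n') (Fin n) ℝ) := detChannel '' {v | IsSaturating f d v}
  let E : Fin n → Matrix (Fin n') (Fin n) ℝ := fun x => Matrix.single (c x) x 1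
  have htop : Submodule.span ℝ S ⊔ Submodule.span ℝ (Set.range E) = ⊤ := by
    by_contra hne
    obtain ⟨ψ, hψ₀, hψ⟩ := Submodule.exists_le_ker_of_lt_top _ (lt_top_iff_ne_top.2 hne)
    have hψA : ∀ v, ψ (detChannel v) = ∑ x, ψ (Matrix.single (v x) x 1) := by
      intro v
      rw [← map_sum]
      congr 1
      ext y x
      rw [Matrix.sum_apply, sum_eq_single x fun z _ hz => by simp [hz]] <;>
        simp [Matrix.single_apply, detChannel_apply]
    have hA := eq_zero_of_sum_saturating_eq_zero (A := fun y x => ψ (Matrix.single y x 1)) hd hr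
      (fun v hv => by
        rw [← hψA]
        exact hψ (Submodule.mem_sup_left (Submodule.subset_span ⟨v, hv, rfl⟩))) c hc
      (fun x => hψ (Submodule.mem_sup_right (Submodule.subset_span ⟨x, rfl⟩)))
    refine hψ₀ (Matrix.ext_linearMap ℝ fun y x => LinearMap.ext_ring ?_)
    simpa using hA y x
  have hcard : n * (n' - 1) ≤ Module.finrank ℝ (Submodule.span ℝ S) := by
    have h₁ := Submodule.finrank_add_le_finrank_add_finrank (Submodule.span ℝ S)
      (Submodule.span ℝ (Set.range E))
    have h₂ : Module.finrank ℝ (Submodule.span ℝ (Set.range E)) ≤ Fintype.card (Fin n) :=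
      finrank_range_le_card E
    rw [htop, finrank_top, Module.finrank_matrix] at h₁
    simp only [Fintype.card_fin, Module.finrank_self, mul_one] at h₁ h₂
    rw [Nat.mul_sub_one, mul_comm n n']
    omega
  obtain ⟨V, hVS, -, hV⟩ := Submodule.exists_fun_fin_finrank_span_eq ℝ S
  refine ⟨V ∘ Fin.castLE hcard, (hV.comp _ (Fin.castLE_injective hcard)).affineIndependent,
    fun i => ?_⟩
  obtain ⟨v, hv, hvi⟩ := hVS (Fin.castLE hcard i)
  rw [Function.comp_apply, ← hvi]
  exact ⟨hv.isVertex, hv.bip_eq hf⟩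

lemma IsVertex.card_image_of_bip_eq (hf : ∀ y x, G y x = if f y = x then 1 else 0)
    (hr : #(univ.image f) ≤ d) (hV : IsVertex d V) (hGV : bip G V = d) :
    #(univ.image f) = d ∧ ∀ y, ∑ z with f z = f y, V z (f y) = 1 := by
  obtain ⟨v, rfl, -⟩ := hV.exists_eq_detChannel
  let F : Finset (Fin n') := {y | v (f y) = y}
  have hFd : #F = d := by rw [bip_detChannel hf] at hGV; exact_mod_cast hGV
  have hinj : #(F.image f) = #F := card_image_of_injOn fun y hy y' hy' h => by
    rw [← (mem_filter.1 hy).2, ← (mem_filter.1 hy').2, h]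
  have himage : F.image f = univ.image f :=
    eq_of_subset_of_card_le (image_subset_image (subset_univ F)) (by omega)
  refine ⟨by rw [← himage, hinj, hFd], fun y => ?_⟩
  obtain ⟨z, hz, hzy⟩ := mem_image.1 (himage ▸ mem_image_of_mem f (mem_univ y) : f y ∈ F.image f)
  have hvz : f (v (f y)) = f y := by rw [← hzy, (mem_filter.1 hz).2]
  simp [detChannel_apply, hvz]

/-- Column sums, together with the weights that two given columns put on the fibres of `f`. -/
def fibreWeights (f : Fin n' → Fin n) (x₁ x₂ : Fin n) :
    Matrix (Fin n') (Fin n) ℝ →ₗ[ℝ] (Fin n → ℝ) × ℝ × ℝ where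
  toFun P := (fun x => ∑ y, P y x, ∑ y with f y = x₁, P y x₁, ∑ y with f y = x₂, P y x₂)
  map_add' P Q := by ext <;> simp [sum_add_distrib]
  map_smul' c P := by ext <;> simp [mul_sum]

lemma fibreWeights_surjective {y₁ y₂ : Fin n'} (h : f y₁ ≠ f y₂) :
    Function.Surjective (fibreWeights f (f y₁) (f y₂)) := by
  have hy : y₁ ≠ y₂ := fun e => h (e ▸ rfl)
  rintro ⟨a, b₁, b₂⟩
  let p : Fin n → ℝ := fun x => if x = f y₁ then b₁ else if x = f y₂ then a x - b₂ else a x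
  refine ⟨Matrix.of fun y x => if y = y₁ then p x else if y = y₂ then a x - p x else 0, ?_⟩
  have hsplit : ∀ (y : Fin n') (s t : ℝ),
      (if y = y₁ then s else if y = y₂ then t else 0) =
        (if y = y₁ then s else 0) + if y = y₂ then t else 0 := by
    intro y s t
    by_cases h₁ : y = y₁
    · simp [h₁, hy]
    · simp [h₁]
  ext <;> simp [fibreWeights, hsplit, sum_add_distrib, p, h, h.symm]

lemma not_isTightBell_of_card_image_le (hd : 1 < d) (hn : d < n) (hn' : d < n')
    (hr : #(univ.image f) ≤ d) (hf : ∀ y x, G y x = if f y = x then 1 else 0) :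
    ¬ IsTightBell n n' d G d := by
  rintro ⟨-, V, hV, hVG⟩
  have hpos : 0 < n * (n' - 1) := Nat.mul_pos (by omega) (by omega)
  obtain ⟨m, hm⟩ : ∃ m, n * (n' - 1) = m + 1 := ⟨n * (n' - 1) - 1, by omega⟩
  have hsat := fun i => (hVG i).1.card_image_of_bip_eq hf hr (hVG i).2
  obtain ⟨x₁, hx₁, x₂, hx₂, hx⟩ := one_lt_card.1 (hd.trans_eq (hsat ⟨0, hpos⟩).1.symm)
  obtain ⟨y₁, -, rfl⟩ := mem_image.1 hx₁
  obtain ⟨y₂, -, rfl⟩ := mem_image.1 hx₂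
  have hK : ∀ i, fibreWeights f (f y₁) (f y₂) (V i) = (1, 1, 1) := fun i => by
    simp only [fibreWeights, LinearMap.coe_mk, AddHom.coe_mk, (hsat i).2, (hVG i).1.1.2]
    rfl
  have hle : vectorSpan ℝ (Set.range V) ≤ (fibreWeights f (f y₁) (f y₂)).ker := by
    rw [vectorSpan_def, Submodule.span_le]
    rintro _ ⟨_, ⟨i, rfl⟩, _, ⟨j, rfl⟩, rfl⟩
    simp [hK]
  have h₁ := Submodule.finrank_mono hle
  rw [hV.finrank_vectorSpan (n := m) (by simp [hm])] at h₁
  have h₂ := (fibreWeights f (f y₁) (f y₂)).finrank_range_add_finrank_ker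
  rw [LinearMap.range_eq_top.2 (fibreWeights_surjective hx), finrank_top,
    Module.finrank_matrix] at h₂
  simp only [Module.finrank_prod, Module.finrank_fintype_fun_eq_card, Fintype.card_fin,
    Module.finrank_self, mul_one] at h₂
  rw [Nat.mul_sub_one, mul_comm n n'] at hm
  omega

end Channels

/-- Proposition 2(i) (rank form): for `min{n,n'} > d > 1`, a maximum-likelihood-type
game matrix `G` (each row 0/1 with exactly one 1) gives a tight Bell inequality
`(G, d)` of `C_d^{n → n'}` iff `rank G > d`. -/
theorem mlGame_tightBell_iff_rank (n n' d : ℕ) (hd : 1 < d) (hdm : d < min n n')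
    (G : Matrix (Fin n') (Fin n) ℝ)
    (hG : ∀ y, ∃ x₀, G y x₀ = 1 ∧ ∀ x, x ≠ x₀ → G y x = 0) :
    IsTightBell n n' d G (d : ℝ) ↔ d < G.rank := by
  choose f hf₁ hf₀ using hG
  have hf : ∀ y x, G y x = if f y = x then 1 else 0 := fun y x => by
    split_ifs with h
    · rw [← h, hf₁]
    · exact hf₀ y x (Ne.symm h)
  rw [rank_eq_card_image hf]
  obtain ⟨hn, hn'⟩ := lt_min_iff.1 hdm
  refine ⟨fun h => ?_, fun h => isTightBell_of_lt_card_image hd h hf⟩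
  by_contra hr
  exact not_isTightBell_of_card_image_le hd hn hn' (not_lt.1 hr) hf h
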